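/- arXiv:2208.01907 — 5 statements merged into one kernel-verified Lean document; each statement's English description precedes it below -/
import Mathlib

section
/- Let A and Q be invertible real N×N matrices and b ∈ ℝ^N. For the iterative refinement sequence x_0 = Q⁻¹b, r_n = b − A x_n, x_{n+1} = x_n + Q⁻¹ r_n, the binomial expansion of the iterate holds: for every n ≥ 1, x_n = x_0 + Σ_{k=0}^{n−1} (−1)^k · binom(n, k+1) · (Q⁻¹·A)^k · Q⁻¹ · r_0. -/
open Matrix

theorem one_sub_pow_eq_sum {𝕜 R : Type*} [CommRing 𝕜] [Ring R] [Algebra 𝕜 R] (a : R) (n : ℕ) :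
    (1 - a) ^ n =
      ∑ k ∈ Finset.range (n + 1), ((-1 : 𝕜) ^ k * (n.choose k : 𝕜)) • a ^ k := by
  rw [sub_eq_neg_add, (Commute.one_right (-a)).add_pow]
  refine Finset.sum_congr rfl fun k _ => ?_
  rw [one_pow, mul_one, neg_pow, Algebra.smul_def, map_mul, map_pow, map_neg, map_one,
    map_natCast, mul_assoc, mul_assoc, (Nat.cast_commute (n.choose k) (a ^ k)).eq]

theorem sum_choose_succ_smul_pow {𝕜 R : Type*} [CommRing 𝕜] [Ring R] [Algebra 𝕜 R]
    (a : R) (n : ℕ) :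
    ∑ k ∈ Finset.range (n + 1), ((-1 : 𝕜) ^ k * ((n + 1).choose (k + 1) : 𝕜)) • a ^ k =
      ∑ k ∈ Finset.range n, ((-1 : 𝕜) ^ k * (n.choose (k + 1) : 𝕜)) • a ^ k + (1 - a) ^ n := by
  simp only [Nat.choose_succ_succ', Nat.cast_add, mul_add, add_smul, Finset.sum_add_distrib]
  rw [← one_sub_pow_eq_sum, Finset.sum_range_succ _ n, Nat.choose_succ_self]
  simp [add_comm]

/-- Binomial expansion of the iterative refinement iterate: for every `n ≥ 1`,
`x n = x 0 + Σ_{k=0}^{n-1} (-1)^k · C(n, k+1) · (Q⁻¹·A)^k · Q⁻¹ · r 0`. -/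
theorem iterative_refinement_binomial_expansion
    (N : ℕ) (hN : 1 ≤ N)
    (A Q : Matrix (Fin N) (Fin N) ℝ) (hA : IsUnit A) (hQ : IsUnit Q)
    (b : Fin N → ℝ) (x r : ℕ → Fin N → ℝ)
    (hx0 : x 0 = Q⁻¹.mulVec b)
    (hr : ∀ n, r n = b - A.mulVec (x n))
    (hx : ∀ n, x (n + 1) = x n + Q⁻¹.mulVec (r n)) :
    ∀ n : ℕ, 1 ≤ n →
      x n = x 0 + ∑ k ∈ Finset.range n,
        ((-1 : ℝ) ^ k * (n.choose (k + 1) : ℝ)) •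
          ((Q⁻¹ * A) ^ k * Q⁻¹).mulVec (r 0) := by
  have increment (n : ℕ) : Q⁻¹ *ᵥ r n = (1 - Q⁻¹ * A) ^ n *ᵥ (Q⁻¹ *ᵥ r 0) := by
    induction n with
    | zero => simp
    | succ n ih =>
      have residual : r (n + 1) = r n - A *ᵥ (Q⁻¹ *ᵥ r n) := by
        rw [hr (n + 1), hx, mulVec_add, ← sub_sub, ← hr n]
      rw [residual, pow_succ', ← mulVec_mulVec, ← ih, sub_mulVec, one_mulVec, mulVec_sub,
        ← mulVec_mulVec]
  have expansion (n : ℕ) : x n = x 0 +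
      (∑ k ∈ Finset.range n, ((-1 : ℝ) ^ k * (n.choose (k + 1) : ℝ)) • (Q⁻¹ * A) ^ k) *ᵥ
        (Q⁻¹ *ᵥ r 0) := by
    induction n with
    | zero => simp
    | succ n ih =>
      rw [hx, increment, sum_choose_succ_smul_pow, add_mulVec, ← add_assoc, ← ih]
  intro n _
  rw [expansion n, sum_mulVec]
  simp only [mulVec_mulVec, smul_mul_assoc, smul_mulVec]
end

section
/- For the right-preconditioned GCR iteration, assuming ⟪A p_m, A p_m⟫ ≠ 0 for every m ≤ n, the search directions are A-conjugate: ⟪A p_m, A p_k⟫ = 0 for all m < k ≤ n + 1. -/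
open Matrix
open scoped RealInnerProductSpace

/-- In the right-preconditioned GCR iteration, the search directions are A-conjugate:
if `⟪A p m, A p m⟫ ≠ 0` for every `m ≤ n`, then `⟪A p m, A p k⟫ = 0`
for all `m < k ≤ n + 1`. -/
theorem gcr_search_directions_conjugate
    (N : ℕ) (hN : 1 ≤ N)
    (A Q : Matrix (Fin N) (Fin N) ℝ) (hA : IsUnit A) (hQ : IsUnit Q)
    (b : EuclideanSpace ℝ (Fin N))
    (x r p w : ℕ → EuclideanSpace ℝ (Fin N))
    (α : ℕ → ℝ) (β : ℕ → ℕ → ℝ)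
    (hx0 : x 0 = Matrix.toEuclideanLin Q⁻¹ b)
    (hr0 : r 0 = b - Matrix.toEuclideanLin A (x 0))
    (hp0 : p 0 = Matrix.toEuclideanLin Q⁻¹ (r 0))
    (hα : ∀ n, α n = ⟪r n, Matrix.toEuclideanLin A (p n)⟫ /
      ⟪Matrix.toEuclideanLin A (p n), Matrix.toEuclideanLin A (p n)⟫)
    (hx : ∀ n, x (n + 1) = x n + α n • p n)
    (hr : ∀ n, r (n + 1) = r n - α n • Matrix.toEuclideanLin A (p n))
    (hw : ∀ n, w (n + 1) = Matrix.toEuclideanLin Q⁻¹ (r (n + 1)))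
    (hβ : ∀ m n, m ≤ n → β m n =
      -⟪Matrix.toEuclideanLin A (w (n + 1)), Matrix.toEuclideanLin A (p m)⟫ /
        ⟪Matrix.toEuclideanLin A (p m), Matrix.toEuclideanLin A (p m)⟫)
    (hp : ∀ n, p (n + 1) = w (n + 1) + ∑ m ∈ Finset.range (n + 1), β m n • p m)
    (n : ℕ)
    (hnz : ∀ m ≤ n, ⟪Matrix.toEuclideanLin A (p m), Matrix.toEuclideanLin A (p m)⟫ ≠ 0) :
    ∀ m k, m < k → k ≤ n + 1 →
      ⟪Matrix.toEuclideanLin A (p m), Matrix.toEuclideanLin A (p k)⟫ = 0 := by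
  intro m k
  induction k using Nat.strong_induction_on generalizing m with
  | _ k ih =>
    intro hmk hk
    obtain ⟨j, rfl⟩ : ∃ j, k = j + 1 := ⟨k - 1, by omega⟩
    have hmj : m ≤ j := by omega
    have hsum : ∑ i ∈ Finset.range (j + 1),
        β i j * ⟪Matrix.toEuclideanLin A (p m), Matrix.toEuclideanLin A (p i)⟫ =
        β m j * ⟪Matrix.toEuclideanLin A (p m), Matrix.toEuclideanLin A (p m)⟫ := by
      refine Finset.sum_eq_single_of_mem m (Finset.mem_range.2 hmk) fun i hi him => ?_
      rw [Finset.mem_range] at hi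
      rcases lt_or_gt_of_ne him with h | h
      · rw [real_inner_comm, ih m hmk i h (by omega), mul_zero]
      · rw [ih i hi m h (by omega), mul_zero]
    simp only [hp j, map_add, map_sum, map_smul, inner_add_right, inner_sum, inner_smul_right]
    rw [hsum, hβ m j hmj, div_mul_cancel₀ _ (hnz m (by omega)), real_inner_comm, add_neg_cancel]
end

section
/- For the right-preconditioned GCR iteration, assuming ⟪A p_m, A p_m⟫ ≠ 0 for every m ≤ n, the residual is orthogonal to all previous search directions mapped by A: ⟪r_{n+1}, A p_m⟫ = 0 for all 0 ≤ m ≤ n. -/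
open Matrix
open scoped RealInnerProductSpace

section GramSchmidt

variable {E : Type*} [NormedAddCommGroup E] [InnerProductSpace ℝ E]

/-- Classical Gram–Schmidt orthogonalization produces pairwise orthogonal vectors
(vanishing vectors are allowed, since division by zero yields zero). -/
theorem inner_eq_zero_of_gramSchmidt_recurrence {u v : ℕ → E}
    (hv : ∀ n, v (n + 1) = u n - ∑ m ∈ Finset.range (n + 1), (⟪u n, v m⟫ / ⟪v m, v m⟫) • v m)
    {k m : ℕ} (hmk : m < k) : ⟪v k, v m⟫ = 0 := by
  induction k using Nat.strong_induction_on generalizing m with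
  | _ k ih =>
    obtain ⟨n, rfl⟩ : ∃ n, k = n + 1 := ⟨k - 1, by omega⟩
    have hsum : ∑ j ∈ Finset.range (n + 1), ⟪(⟪u n, v j⟫ / ⟪v j, v j⟫) • v j, v m⟫ =
        ⟪(⟪u n, v m⟫ / ⟪v m, v m⟫) • v m, v m⟫ := by
      refine Finset.sum_eq_single_of_mem m (Finset.mem_range.2 hmk) fun j hj hjm => ?_
      rw [real_inner_smul_left]
      rcases lt_or_gt_of_ne hjm with h | h
      · rw [real_inner_comm (v m) (v j), ih m hmk h, mul_zero]
      · rw [ih j (Finset.mem_range.1 hj) h, mul_zero]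
    rw [hv, inner_sub_left, sum_inner, hsum, real_inner_smul_left]
    rcases eq_or_ne (v m) 0 with h | h
    · simp [h]
    · rw [div_mul_cancel₀ _ (inner_self_ne_zero.2 h), sub_self]

/-- Successively removing from `r 0` its components along pairwise orthogonal vectors `v n`
leaves a residual orthogonal to all vectors used so far. -/
theorem inner_residual_eq_zero {r v : ℕ → E}
    (hr : ∀ n, r (n + 1) = r n - (⟪r n, v n⟫ / ⟪v n, v n⟫) • v n)
    (hv : ∀ k m, m < k → ⟪v k, v m⟫ = 0) {n m : ℕ} (hmn : m ≤ n) :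
    ⟪r (n + 1), v m⟫ = 0 := by
  induction n, hmn using Nat.le_induction with
  | base =>
    rw [hr, inner_sub_left, real_inner_smul_left]
    rcases eq_or_ne (v m) 0 with h | h
    · simp [h]
    · rw [div_mul_cancel₀ _ (inner_self_ne_zero.2 h), sub_self]
  | succ n hmn ih =>
    rw [hr, inner_sub_left, real_inner_smul_left, ih, hv _ _ (Nat.lt_succ_of_le hmn), mul_zero,
      sub_zero]

end GramSchmidt

/-- In the right-preconditioned GCR iteration, the residual is orthogonal to all previous
search directions mapped by `A`: `⟪r (n+1), A p m⟫ = 0` for all `0 ≤ m ≤ n`. -/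
theorem gcr_residual_orthogonality
    (N : ℕ) (hN : 1 ≤ N)
    (A Q : Matrix (Fin N) (Fin N) ℝ) (hA : IsUnit A) (hQ : IsUnit Q)
    (b : EuclideanSpace ℝ (Fin N))
    (x r p w : ℕ → EuclideanSpace ℝ (Fin N))
    (α : ℕ → ℝ) (β : ℕ → ℕ → ℝ)
    (hx0 : x 0 = Matrix.toEuclideanLin Q⁻¹ b)
    (hr0 : r 0 = b - Matrix.toEuclideanLin A (x 0))
    (hp0 : p 0 = Matrix.toEuclideanLin Q⁻¹ (r 0))
    (hα : ∀ n, α n = ⟪r n, Matrix.toEuclideanLin A (p n)⟫ /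
      ⟪Matrix.toEuclideanLin A (p n), Matrix.toEuclideanLin A (p n)⟫)
    (hx : ∀ n, x (n + 1) = x n + α n • p n)
    (hr : ∀ n, r (n + 1) = r n - α n • Matrix.toEuclideanLin A (p n))
    (hw : ∀ n, w (n + 1) = Matrix.toEuclideanLin Q⁻¹ (r (n + 1)))
    (hβ : ∀ m n, m ≤ n → β m n =
      -⟪Matrix.toEuclideanLin A (w (n + 1)), Matrix.toEuclideanLin A (p m)⟫ /
        ⟪Matrix.toEuclideanLin A (p m), Matrix.toEuclideanLin A (p m)⟫)
    (hp : ∀ n, p (n + 1) = w (n + 1) + ∑ m ∈ Finset.range (n + 1), β m n • p m)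
    (n : ℕ)
    (hnz : ∀ m ≤ n, ⟪Matrix.toEuclideanLin A (p m), Matrix.toEuclideanLin A (p m)⟫ ≠ 0) :
    ∀ m ≤ n, ⟪r (n + 1), Matrix.toEuclideanLin A (p m)⟫ = 0 := by
  intro m hm
  refine inner_residual_eq_zero (v := fun k => Matrix.toEuclideanLin A (p k))
    (fun k => by rw [hr, hα]) (fun k j hjk => ?_) hm
  refine inner_eq_zero_of_gramSchmidt_recurrence
    (u := fun k => Matrix.toEuclideanLin A (w (k + 1)))
    (v := fun k => Matrix.toEuclideanLin A (p k)) (fun k => ?_) hjk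
  rw [hp, map_add, map_sum, sub_eq_add_neg, ← Finset.sum_neg_distrib]
  congr 1
  refine Finset.sum_congr rfl fun i hi => ?_
  rw [map_smul, hβ i k (Nat.lt_succ_iff.1 (Finset.mem_range.1 hi)), neg_div, neg_smul]
end

section
/- For the right-preconditioned GCR iteration, assuming ⟪A p_m, A p_m⟫ ≠ 0 for every m < n, the iterate x_n minimizes the residual over the affine Krylov space: for every x ∈ x_0 + K_n(Q⁻¹ r_0, Q⁻¹·A), ‖b − A x_n‖ ≤ ‖b − A x‖, where ‖·‖ is the Euclidean norm. -/
open Matrix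
open scoped RealInnerProductSpace

section GCR

variable {E : Type*} [NormedAddCommGroup E] [InnerProductSpace ℝ E]

theorem mem_span_image_Iio {p : ℕ → E} {w : E} {c : ℕ → ℝ} {k : ℕ}
    (hp : p k = w + ∑ m ∈ Finset.range k, c m • p m) :
    w ∈ Submodule.span ℝ (p '' Set.Iio (k + 1)) := by
  rw [eq_sub_of_add_eq hp.symm]
  refine Submodule.sub_mem _ (Submodule.subset_span ⟨k, Nat.lt_succ_self k, rfl⟩)
    (Submodule.sum_mem _ fun m hm => Submodule.smul_mem _ _ (Submodule.subset_span ⟨m, ?_, rfl⟩))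
  have := Finset.mem_range.mp hm
  simp only [Set.mem_Iio]
  omega

theorem inner_map_eq_zero_of_mem_span {A : E →ₗ[ℝ] E} {s : Set E} {v y : E}
    (h : ∀ u ∈ s, ⟪v, A u⟫ = 0) (hy : y ∈ Submodule.span ℝ s) : ⟪v, A y⟫ = 0 := by
  induction hy using Submodule.span_induction with
  | mem u hu => exact h u hu
  | zero => simp
  | add u u' _ _ hu hu' => rw [map_add, inner_add_right, hu, hu', add_zero]
  | smul c u _ hu => rw [map_smul, inner_smul_right, hu, mul_zero]

theorem gcr_direction_orthogonal {A : E →ₗ[ℝ] E} {p w : ℕ → E} {β : ℕ → ℕ → ℝ} {n : ℕ}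
    (hβ : ∀ m n, m ≤ n → β m n = -⟪A (w (n + 1)), A (p m)⟫ / ⟪A (p m), A (p m)⟫)
    (hp : ∀ n, p (n + 1) = w (n + 1) + ∑ m ∈ Finset.range (n + 1), β m n • p m)
    (hnz : ∀ m < n, ⟪A (p m), A (p m)⟫ ≠ 0) (k : ℕ) (hk : k ≤ n) :
    ∀ m < k, ⟪A (p k), A (p m)⟫ = 0 := by
  induction k using Nat.strong_induction_on with
  | _ k ih =>
    intro m hm
    obtain ⟨k, rfl⟩ : ∃ j, k = j + 1 := ⟨k - 1, by omega⟩
    have hsum : ∑ j ∈ Finset.range (k + 1), ⟪β j k • A (p j), A (p m)⟫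
        = β m k * ⟪A (p m), A (p m)⟫ := by
      rw [Finset.sum_eq_single_of_mem m (Finset.mem_range.mpr hm), real_inner_smul_left]
      intro j hj hjm
      have hj := Finset.mem_range.mp hj
      rw [real_inner_smul_left]
      rcases lt_or_gt_of_ne hjm with h | h
      · rw [real_inner_comm, ih m hm (by omega) j h, mul_zero]
      · rw [ih j hj (by omega) m h, mul_zero]
    rw [hp, map_add, map_sum, inner_add_left, sum_inner]
    simp only [map_smul]
    rw [hsum, hβ m k (by omega), div_mul_cancel₀ _ (hnz m (by omega)), add_neg_cancel]

theorem gcr_residual_orthogonal {A : E →ₗ[ℝ] E} {r p : ℕ → E} {α : ℕ → ℝ} {n : ℕ}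
    (hα : ∀ n, α n = ⟪r n, A (p n)⟫ / ⟪A (p n), A (p n)⟫)
    (hr : ∀ n, r (n + 1) = r n - α n • A (p n))
    (horth : ∀ k ≤ n, ∀ m < k, ⟪A (p k), A (p m)⟫ = 0)
    (hnz : ∀ m < n, ⟪A (p m), A (p m)⟫ ≠ 0) (k : ℕ) (hk : k ≤ n) :
    ∀ m < k, ⟪r k, A (p m)⟫ = 0 := by
  induction k with
  | zero => simp
  | succ k ih =>
    intro m hm
    rw [hr, inner_sub_left, real_inner_smul_left]
    rcases Nat.lt_succ_iff_lt_or_eq.mp hm with h | rfl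
    · rw [ih (by omega) m h, horth k (by omega) m h, mul_zero, sub_zero]
    · rw [hα, div_mul_cancel₀ _ (hnz m hk), sub_self]

/-- A vanishing step length forces the next search direction to break down; otherwise the
preconditioned operator sends the `k`-th direction into the span of the first `k + 2`. -/
theorem gcr_map_direction_mem_span {A S : E →ₗ[ℝ] E} {r p : ℕ → E} {α : ℕ → ℝ}
    {β : ℕ → ℕ → ℝ} {k : ℕ}
    (hr : r (k + 1) = r k - α k • A (p k))
    (hp : p (k + 1) = S (r (k + 1)) + ∑ m ∈ Finset.range (k + 1), β m k • p m)
    (hw : S (r k) ∈ Submodule.span ℝ (p '' Set.Iio (k + 1)))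
    (horth : ∀ m < k + 1, ⟪A (p (k + 1)), A (p m)⟫ = 0)
    (hnz : ⟪A (p (k + 1)), A (p (k + 1))⟫ ≠ 0) :
    S (A (p k)) ∈ Submodule.span ℝ (p '' Set.Iio (k + 2)) := by
  have hα : α k ≠ 0 := by
    intro h0
    rw [h0, zero_smul, sub_zero] at hr
    refine hnz (inner_map_eq_zero_of_mem_span (s := p '' Set.Iio (k + 1)) ?_ ?_)
    · rintro _ ⟨m, hm, rfl⟩
      exact horth m hm
    · rw [hp, hr]
      exact Submodule.add_mem _ hw (Submodule.sum_mem _ fun m hm => Submodule.smul_mem _ _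
        (Submodule.subset_span ⟨m, Finset.mem_range.mp hm, rfl⟩))
  have hmono : Submodule.span ℝ (p '' Set.Iio (k + 1)) ≤ Submodule.span ℝ (p '' Set.Iio (k + 2)) :=
    Submodule.span_mono (Set.image_mono (Set.Iio_subset_Iio (by omega)))
  have hA : S (A (p k)) = (α k)⁻¹ • (S (r k) - S (r (k + 1))) := by
    rw [hr, map_sub, sub_sub_cancel, map_smul, inv_smul_smul₀ hα]
  rw [hA]
  exact Submodule.smul_mem _ _ (Submodule.sub_mem _ (hmono hw) (mem_span_image_Iio hp))

theorem gcr_krylov_mem_span {A S : E →ₗ[ℝ] E} {r p : ℕ → E} {α : ℕ → ℝ}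
    {β : ℕ → ℕ → ℝ} {n : ℕ}
    (hp0 : p 0 = S (r 0))
    (hr : ∀ n, r (n + 1) = r n - α n • A (p n))
    (hp : ∀ n, p (n + 1) = S (r (n + 1)) + ∑ m ∈ Finset.range (n + 1), β m n • p m)
    (horth : ∀ k ≤ n, ∀ m < k, ⟪A (p k), A (p m)⟫ = 0)
    (hnz : ∀ m < n, ⟪A (p m), A (p m)⟫ ≠ 0) (k : ℕ) (hk : k < n) :
    ((S ∘ₗ A) ^ k) (S (r 0)) ∈ Submodule.span ℝ (p '' Set.Iio (k + 1)) := by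
  have hw : ∀ j, S (r j) ∈ Submodule.span ℝ (p '' Set.Iio (j + 1)) := by
    rintro (_ | j)
    · rw [← hp0]
      exact Submodule.subset_span ⟨0, by simp, rfl⟩
    · exact mem_span_image_Iio (hp j)
  induction k with
  | zero => simpa using hw 0
  | succ k ih =>
    have hle : Submodule.span ℝ (p '' Set.Iio (k + 1)) ≤
        (Submodule.span ℝ (p '' Set.Iio (k + 2))).comap (S ∘ₗ A) := by
      rw [Submodule.span_le]
      rintro _ ⟨j, hj, rfl⟩
      have hj : j < k + 1 := hj
      exact Submodule.span_mono (Set.image_mono (Set.Iio_subset_Iio (by omega)))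
        (gcr_map_direction_mem_span (hr j) (hp j) (hw j) (horth (j + 1) (by omega))
          (hnz (j + 1) (by omega)))
    rw [pow_succ', Module.End.mul_apply]
    exact hle (ih (by omega))

theorem gcr_iterate_sub_mem_span {x p : ℕ → E} {α : ℕ → ℝ}
    (hx : ∀ n, x (n + 1) = x n + α n • p n) (n : ℕ) :
    x n - x 0 ∈ Submodule.span ℝ (p '' Set.Iio n) := by
  induction n with
  | zero => simp
  | succ n ih =>
    rw [hx, add_sub_right_comm]
    exact Submodule.add_mem _
      (Submodule.span_mono (Set.image_mono (Set.Iio_subset_Iio (by omega))) ih)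
      (Submodule.smul_mem _ _ (Submodule.subset_span ⟨n, by simp, rfl⟩))

theorem gcr_residual_eq {A : E →ₗ[ℝ] E} {b : E} {x r p : ℕ → E} {α : ℕ → ℝ}
    (hr0 : r 0 = b - A (x 0))
    (hx : ∀ n, x (n + 1) = x n + α n • p n)
    (hr : ∀ n, r (n + 1) = r n - α n • A (p n)) (n : ℕ) :
    r n = b - A (x n) := by
  induction n with
  | zero => exact hr0
  | succ n ih => rw [hr, hx, ih, map_add, map_smul, sub_sub]

theorem norm_le_norm_sub_of_inner_eq_zero {u v : E} (h : ⟪u, v⟫ = 0) : ‖u‖ ≤ ‖u - v‖ := by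
  have := norm_sub_sq_eq_norm_sq_add_norm_sq_real h
  nlinarith [norm_nonneg u, norm_nonneg (u - v), mul_self_nonneg ‖v‖]

end GCR

/-- In the right-preconditioned GCR iteration, the iterate `x n` minimizes the Euclidean
residual norm over the affine Krylov space `x 0 + K_n(Q⁻¹ r 0, Q⁻¹·A)`. -/
theorem gcr_residual_minimization
    (N : ℕ) (hN : 1 ≤ N)
    (A Q : Matrix (Fin N) (Fin N) ℝ) (hA : IsUnit A) (hQ : IsUnit Q)
    (b : EuclideanSpace ℝ (Fin N))
    (x r p w : ℕ → EuclideanSpace ℝ (Fin N))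
    (α : ℕ → ℝ) (β : ℕ → ℕ → ℝ)
    (hx0 : x 0 = Matrix.toEuclideanLin Q⁻¹ b)
    (hr0 : r 0 = b - Matrix.toEuclideanLin A (x 0))
    (hp0 : p 0 = Matrix.toEuclideanLin Q⁻¹ (r 0))
    (hα : ∀ n, α n = ⟪r n, Matrix.toEuclideanLin A (p n)⟫ /
      ⟪Matrix.toEuclideanLin A (p n), Matrix.toEuclideanLin A (p n)⟫)
    (hx : ∀ n, x (n + 1) = x n + α n • p n)
    (hr : ∀ n, r (n + 1) = r n - α n • Matrix.toEuclideanLin A (p n))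
    (hw : ∀ n, w (n + 1) = Matrix.toEuclideanLin Q⁻¹ (r (n + 1)))
    (hβ : ∀ m n, m ≤ n → β m n =
      -⟪Matrix.toEuclideanLin A (w (n + 1)), Matrix.toEuclideanLin A (p m)⟫ /
        ⟪Matrix.toEuclideanLin A (p m), Matrix.toEuclideanLin A (p m)⟫)
    (hp : ∀ n, p (n + 1) = w (n + 1) + ∑ m ∈ Finset.range (n + 1), β m n • p m)
    (n : ℕ) (hn : 1 ≤ n)
    (hnz : ∀ m < n, ⟪Matrix.toEuclideanLin A (p m), Matrix.toEuclideanLin A (p m)⟫ ≠ 0) :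
    ∀ y : EuclideanSpace ℝ (Fin N),
      y - x 0 ∈ Submodule.span ℝ
        (Set.range fun k : Fin n =>
          Matrix.toEuclideanLin ((Q⁻¹ * A) ^ (k : ℕ) * Q⁻¹) (r 0)) →
      ‖b - Matrix.toEuclideanLin A (x n)‖ ≤ ‖b - Matrix.toEuclideanLin A y‖ := by
  intro y hy
  set L := Matrix.toEuclideanLin A with hL
  set S := Matrix.toEuclideanLin Q⁻¹ with hS
  have hp' : ∀ n, p (n + 1) = S (r (n + 1)) + ∑ m ∈ Finset.range (n + 1), β m n • p m :=
    fun n => by rw [hp, hw]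
  have horth := gcr_direction_orthogonal hβ hp hnz
  have hres := gcr_residual_orthogonal hα hr horth hnz n le_rfl
  have hKrylov : y - x 0 ∈ Submodule.span ℝ (p '' Set.Iio n) := by
    refine Submodule.span_le.mpr ?_ hy
    rintro _ ⟨k, rfl⟩
    have hpow : Matrix.toEuclideanLin ((Q⁻¹ * A) ^ (k : ℕ) * Q⁻¹) (r 0)
        = ((S ∘ₗ L) ^ (k : ℕ)) (S (r 0)) := by
      rw [Matrix.toLpLin_mul_same, Matrix.toLpLin_pow, Matrix.toLpLin_mul_same]
      rfl
    simp only [hpow]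
    exact Submodule.span_mono (Set.image_mono (Set.Iio_subset_Iio k.isLt))
      (gcr_krylov_mem_span hp0 hr hp' horth hnz k k.isLt)
  have hinner : ⟪r n, L (y - x n)⟫ = 0 := by
    refine inner_map_eq_zero_of_mem_span (s := p '' Set.Iio n) ?_ ?_
    · rintro _ ⟨m, hm, rfl⟩
      exact hres m hm
    · rw [← sub_sub_sub_cancel_right y (x n) (x 0)]
      exact Submodule.sub_mem _ hKrylov (gcr_iterate_sub_mem_span hx n)
  have hy_eq : b - L y = r n - L (y - x n) := by
    rw [gcr_residual_eq hr0 hx hr n, map_sub]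
    abel
  rw [← gcr_residual_eq hr0 hx hr n, hy_eq]
  exact norm_le_norm_sub_of_inner_eq_zero hinner
end

section
/- For the right-preconditioned block GCR iteration with M right-hand sides, assume the Gram matrices 𝓜_n = (A P_n)ᵀ (A P_n) are invertible for all steps up to n. Then: (i) every column x_n^{(k)} of the iterate X_n satisfies x_n^{(k)} ∈ x_0^{(k)} + span{ (Q⁻¹·A)^j · Q⁻¹ · r_0^{(i)} : 0 ≤ j ≤ n−1, 1 ≤ i ≤ M } (the block Krylov subspace of order n), and (ii) every column r_n^{(k)} of the residual R_n is orthogonal to the image under A·Q⁻¹ of the block Krylov space: ⟪r_n^{(k)}, A·Q⁻¹ y⟫ = 0 for every y ∈ span{ (A·Q⁻¹)^j · r_0^{(i)} : 0 ≤ j ≤ n−1, 1 ≤ i ≤ M }. -/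
open Matrix

section BlockColumns

variable {ι κ : Type*}

/-- If the columns of `Y` lie in a subspace, so do the columns of `Y * C`. -/
theorem Matrix.col_mul_mem [Fintype κ] {V : Submodule ℝ (ι → ℝ)} {Y : Matrix ι κ ℝ}
    (hY : ∀ i, Y.col i ∈ V) (C : Matrix κ κ ℝ) (i : κ) : (Y * C).col i ∈ V := by
  have h : (Y * C).col i = ∑ j, C j i • Y.col j := by
    ext l
    simp [Matrix.mul_apply, Finset.sum_apply, mul_comm]
  rw [h]
  exact V.sum_mem fun j _ => V.smul_mem _ (hY j)

/-- If the columns of each summand lie in a subspace, so do the columns of the sum. -/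
theorem Matrix.col_sum_mem {V : Submodule ℝ (ι → ℝ)} {s : Finset ℕ} {f : ℕ → Matrix ι κ ℝ}
    (hf : ∀ m ∈ s, ∀ i, (f m).col i ∈ V) (i : κ) : (∑ m ∈ s, f m).col i ∈ V := by
  have h : (∑ m ∈ s, f m).col i = ∑ m ∈ s, (f m).col i := by
    ext x
    simp [Matrix.sum_apply, Finset.sum_apply]
  rw [h]
  exact V.sum_mem fun m hm => hf m hm i

/-- The block Krylov space of order `n` generated by the columns of `R`. -/
def blockKrylov [Fintype ι] [DecidableEq ι] (T : Matrix ι ι ℝ) (R : Matrix ι κ ℝ) (n : ℕ) :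
    Submodule ℝ (ι → ℝ) :=
  Submodule.span ℝ {v | ∃ j < n, ∃ i, v = (T ^ j).mulVec fun l => R l i}

theorem blockKrylov_mono [Fintype ι] [DecidableEq ι] (T : Matrix ι ι ℝ) (R : Matrix ι κ ℝ) :
    Monotone (blockKrylov T R) := by
  intro m n hmn
  refine Submodule.span_mono ?_
  rintro v ⟨j, hj, i, rfl⟩
  exact ⟨j, hj.trans_le hmn, i, rfl⟩

theorem mulVec_mem_blockKrylov_succ [Fintype ι] [DecidableEq ι] {T : Matrix ι ι ℝ}
    {R : Matrix ι κ ℝ} {n : ℕ} {y : ι → ℝ} (hy : y ∈ blockKrylov T R n) :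
    T *ᵥ y ∈ blockKrylov T R (n + 1) := by
  have h : blockKrylov T R n ≤ (blockKrylov T R (n + 1)).comap T.mulVecLin := by
    refine Submodule.span_le.2 ?_
    rintro v ⟨j, hj, i, rfl⟩
    refine Submodule.subset_span ⟨j + 1, by omega, i, ?_⟩
    simp [pow_succ']
  exact h hy

theorem finrank_blockKrylov_le [Fintype ι] [Fintype κ] [DecidableEq ι] (T : Matrix ι ι ℝ)
    (R : Matrix ι κ ℝ) (n : ℕ) :
    Module.finrank ℝ (blockKrylov T R n) ≤ Fintype.card (Fin n × κ) := by
  have h : blockKrylov T R n =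
      Submodule.span ℝ (Set.range fun p : Fin n × κ => (T ^ (p.1 : ℕ)) *ᵥ fun l => R l p.2) := by
    refine congrArg _ (Set.ext fun v => ⟨?_, ?_⟩)
    · rintro ⟨j, hj, i, rfl⟩
      exact ⟨(⟨j, hj⟩, i), rfl⟩
    · rintro ⟨p, rfl⟩
      exact ⟨p.1, p.1.2, p.2, rfl⟩
  rw [h]
  exact finrank_range_le_card _

/-- Block Gram–Schmidt produces mutually orthogonal blocks. -/
theorem transpose_mul_eq_zero_of_block_gramSchmidt [Fintype ι] [Fintype κ] [DecidableEq κ]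
    {G Z : ℕ → Matrix ι κ ℝ}
    (hG : ∀ n, G (n + 1) = Z (n + 1) +
      ∑ m ∈ Finset.range (n + 1), G m * ((G m)ᵀ * G m)⁻¹ * (-((G m)ᵀ * Z (n + 1))))
    {n : ℕ} (hGram : ∀ m < n, IsUnit ((G m)ᵀ * G m)) :
    ∀ l ≤ n, ∀ m < l, (G m)ᵀ * G l = 0 := by
  intro l
  induction l using Nat.strong_induction_on with
  | _ l ih =>
    intro hl m hm
    obtain ⟨l, rfl⟩ : ∃ k, l = k + 1 := ⟨l - 1, by omega⟩
    have hdet := (Matrix.isUnit_iff_isUnit_det _).1 (hGram m (by omega))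
    rw [hG, Matrix.mul_add, Matrix.mul_sum, Finset.sum_eq_single m]
    · rw [← Matrix.mul_assoc, ← Matrix.mul_assoc, Matrix.mul_nonsing_inv _ hdet, Matrix.one_mul,
        add_neg_cancel]
    · intro k hk hkm
      have hk' : k < l + 1 := Finset.mem_range.1 hk
      have h0 : (G m)ᵀ * G k = 0 := by
        rcases lt_or_gt_of_ne hkm with h | h
        · have := congrArg transpose (ih m hm (by omega) k h)
          simpa using this
        · exact ih k hk' (by omega) m h
      rw [← Matrix.mul_assoc, ← Matrix.mul_assoc, h0, Matrix.zero_mul, Matrix.zero_mul]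
    · intro h
      exact absurd (Finset.mem_range.2 hm) h

/-- The columns of mutually orthogonal blocks with invertible Gram matrices are linearly
independent. -/
theorem linearIndependent_col_of_orthogonal_blocks [Fintype ι] [Fintype κ] [DecidableEq κ]
    {G : ℕ → Matrix ι κ ℝ} {n : ℕ}
    (hGram : ∀ m < n, IsUnit ((G m)ᵀ * G m))
    (horth : ∀ l < n, ∀ m < l, (G m)ᵀ * G l = 0) :
    LinearIndependent ℝ fun p : Fin n × κ => (G p.1).col p.2 := by
  rw [Fintype.linearIndependent_iff]
  intro c hc
  have hsum : ∑ l : Fin n, G l *ᵥ (fun i => c (l, i)) = 0 := by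
    rw [Fintype.sum_prod_type] at hc
    rw [← hc]
    refine Finset.sum_congr rfl fun l _ => ?_
    ext x
    simp [Matrix.mulVec, dotProduct, Finset.sum_apply, mul_comm]
  rintro ⟨m, i⟩
  have h0 : ((G m)ᵀ * G m) *ᵥ (fun i => c (m, i)) = 0 := by
    have h := congrArg (fun v => (G m)ᵀ *ᵥ v) hsum
    simp only [Matrix.mulVec_sum, Matrix.mulVec_zero, Matrix.mulVec_mulVec] at h
    rwa [Finset.sum_eq_single m] at h
    · intro l _ hlm
      have h1 : (G m)ᵀ * G l = 0 := by
        rcases lt_or_gt_of_ne hlm with h | h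
        · have := congrArg transpose (horth m m.2 l h)
          simpa using this
        · exact horth l l.2 m h
      rw [h1, Matrix.zero_mulVec]
    · simp
  have h2 := Matrix.mulVec_injective_of_isUnit (hGram m m.2) (h0.trans (Matrix.mulVec_zero _).symm)
  exact congrFun h2 i

end BlockColumns

/-- Right-preconditioned block GCR with `M` right-hand sides: assuming the Gram matrices
`(A Pₘ)ᵀ (A Pₘ)` are invertible up to step `n`, (i) every column of the iterate `X n` lies in
the corresponding affine block Krylov space, and (ii) every column of the residual `R n` is
orthogonal to the image under `A·Q⁻¹` of the block Krylov space. -/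
theorem block_gcr_krylov_and_orthogonality
    (N M : ℕ) (hM : 1 ≤ M) (hNM : M ≤ N)
    (A Q : Matrix (Fin N) (Fin N) ℝ) (hA : IsUnit A) (hQ : IsUnit Q)
    (B : Matrix (Fin N) (Fin M) ℝ)
    (X R P W Z : ℕ → Matrix (Fin N) (Fin M) ℝ)
    (hX0 : X 0 = Q⁻¹ * B)
    (hR0 : R 0 = B - A * X 0)
    (hP0 : P 0 = Q⁻¹ * R 0)
    (hX : ∀ n, X (n + 1) =
      X n + P n * ((A * P n)ᵀ * (A * P n))⁻¹ * ((A * P n)ᵀ * R n))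
    (hR : ∀ n, R (n + 1) =
      R n - (A * P n) * ((A * P n)ᵀ * (A * P n))⁻¹ * ((A * P n)ᵀ * R n))
    (hW : ∀ n, W (n + 1) = Q⁻¹ * R (n + 1))
    (hZ : ∀ n, Z (n + 1) = A * W (n + 1))
    (hP : ∀ n, P (n + 1) = W (n + 1) +
      ∑ m ∈ Finset.range (n + 1),
        P m * ((A * P m)ᵀ * (A * P m))⁻¹ * (-((A * P m)ᵀ * Z (n + 1))))
    (n : ℕ)
    (hGram : ∀ m ≤ n, IsUnit ((A * P m)ᵀ * (A * P m))) :
    (∀ k : Fin M,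
      (fun i => X n i k) - (fun i => X 0 i k) ∈ Submodule.span ℝ
        {v : Fin N → ℝ | ∃ j < n, ∃ i : Fin M,
          v = ((Q⁻¹ * A) ^ j * Q⁻¹).mulVec fun l => R 0 l i}) ∧
    (∀ k : Fin M, ∀ y ∈ Submodule.span ℝ
        {v : Fin N → ℝ | ∃ j < n, ∃ i : Fin M,
          v = ((A * Q⁻¹) ^ j).mulVec fun l => R 0 l i},
      (fun l => R n l k) ⬝ᵥ (A * Q⁻¹).mulVec y = 0) := by
  have hQdet := (Matrix.isUnit_iff_isUnit_det _).1 hQ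
  have hQPc (n : ℕ) : Q⁻¹ * (Q * P n) = P n := by
    rw [← Matrix.mul_assoc, Matrix.nonsing_inv_mul _ hQdet, Matrix.one_mul]
  have hT (n : ℕ) : A * Q⁻¹ * (Q * P n) = A * P n := by rw [Matrix.mul_assoc, hQPc]
  have hQW (n : ℕ) : Q * W (n + 1) = R (n + 1) := by
    rw [hW, ← Matrix.mul_assoc, Matrix.mul_nonsing_inv _ hQdet, Matrix.one_mul]
  have horth : ∀ l ≤ n, ∀ m < l, (A * P m)ᵀ * (A * P l) = 0 := by
    refine transpose_mul_eq_zero_of_block_gramSchmidt (G := fun n => A * P n) (Z := Z) ?_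
      fun m hm => hGram m hm.le
    intro n
    simp only [hP n, Matrix.mul_add, hZ n, Matrix.mul_sum, Matrix.mul_assoc]
  have hres : ∀ l ≤ n, ∀ m < l, (A * P m)ᵀ * R l = 0 := by
    intro l
    induction l with
    | zero => intro _ m hm; omega
    | succ l ih =>
      intro hl m hm
      rw [hR, Matrix.mul_sub, Matrix.mul_assoc (A * P l), ← Matrix.mul_assoc _ (A * P l)]
      rcases Nat.lt_succ_iff_lt_or_eq.1 hm with h | rfl
      · rw [horth l (by omega) m h, ih (by omega) m h]
        simp
      · rw [Matrix.mul_nonsing_inv_cancel_left _ _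
          ((Matrix.isUnit_iff_isUnit_det _).1 (hGram m (by omega))), sub_self]
  have hmem (n : ℕ) : (∀ i, (R n).col i ∈ blockKrylov (A * Q⁻¹) (R 0) (n + 1)) ∧
      ∀ i, (Q * P n).col i ∈ blockKrylov (A * Q⁻¹) (R 0) (n + 1) := by
    induction n using Nat.strong_induction_on with
    | _ n ih =>
      cases n with
      | zero =>
        have h (i : Fin M) : (R 0).col i ∈ blockKrylov (A * Q⁻¹) (R 0) (0 + 1) :=
          Submodule.subset_span ⟨0, by omega, i, by simp; rfl⟩
        refine ⟨h, ?_⟩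
        rwa [hP0, ← Matrix.mul_assoc, Matrix.mul_nonsing_inv _ hQdet, Matrix.one_mul]
      | succ n =>
        have hr (i : Fin M) : (R (n + 1)).col i ∈ blockKrylov (A * Q⁻¹) (R 0) (n + 1 + 1) := by
          have h1 := blockKrylov_mono (A * Q⁻¹) (R 0) (Nat.le_succ (n + 1))
            ((ih n (by omega)).1 i)
          have h2 (i : Fin M) : (A * P n).col i ∈ blockKrylov (A * Q⁻¹) (R 0) (n + 1 + 1) := by
            rw [← hT]
            exact mulVec_mem_blockKrylov_succ ((ih n (by omega)).2 i)
          rw [hR, Matrix.mul_assoc]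
          exact Submodule.sub_mem _ h1 (Matrix.col_mul_mem h2 _ i)
        refine ⟨hr, fun i => ?_⟩
        rw [hP, Matrix.mul_add, hQW, Matrix.mul_sum]
        refine Submodule.add_mem _ (hr i) (Matrix.col_sum_mem (s := Finset.range (n + 1))
          (f := fun m => Q * (P m * ((A * P m)ᵀ * (A * P m))⁻¹ * (-((A * P m)ᵀ * Z (n + 1)))))
          (fun m hm i => ?_) i)
        have hmn := Finset.mem_range.1 hm
        rw [Matrix.mul_assoc, ← Matrix.mul_assoc Q]
        exact Matrix.col_mul_mem (fun i => blockKrylov_mono _ _ (by omega) ((ih m hmn).2 i)) _ i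
  refine ⟨fun k => ?_, fun k y hy => ?_⟩
  · have hpow (j : ℕ) : Q⁻¹ * (A * Q⁻¹) ^ j = (Q⁻¹ * A) ^ j * Q⁻¹ := by
      induction j with
      | zero => simp
      | succ j ih => rw [pow_succ, ← Matrix.mul_assoc, ih, pow_succ]; simp only [Matrix.mul_assoc]
    have hmap (m : ℕ) : blockKrylov (A * Q⁻¹) (R 0) m ≤ (Submodule.span ℝ
        {v : Fin N → ℝ | ∃ j < m, ∃ i : Fin M,
          v = ((Q⁻¹ * A) ^ j * Q⁻¹).mulVec fun l => R 0 l i}).comap (Q⁻¹).mulVecLin := by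
      refine Submodule.span_le.2 ?_
      rintro v ⟨j, hj, i, rfl⟩
      refine Submodule.subset_span ⟨j, hj, i, ?_⟩
      simp [hpow]
    have hiter : ∀ m ≤ n, (X m).col k - (X 0).col k ∈ Submodule.span ℝ
        {v : Fin N → ℝ | ∃ j < n, ∃ i : Fin M,
          v = ((Q⁻¹ * A) ^ j * Q⁻¹).mulVec fun l => R 0 l i} := by
      intro m
      induction m with
      | zero => simp
      | succ m ih =>
        intro hm
        have hPm (i : Fin M) : (P m).col i ∈ Submodule.span ℝ
            {v : Fin N → ℝ | ∃ j < n, ∃ i : Fin M,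
              v = ((Q⁻¹ * A) ^ j * Q⁻¹).mulVec fun l => R 0 l i} := by
          rw [← hQPc]
          exact hmap n (blockKrylov_mono _ _ hm ((hmem m).2 i))
        have h := Submodule.add_mem _ (ih (by omega)) (Matrix.col_mul_mem hPm
          (((A * P m)ᵀ * (A * P m))⁻¹ * ((A * P m)ᵀ * R m)) k)
        convert h using 1
        rw [hX, Matrix.mul_assoc (P m)]
        ext x
        simp only [Pi.sub_apply, Pi.add_apply, Matrix.col_apply, Matrix.add_apply]
        ring
    exact hiter n le_rfl
  · have hind : LinearIndependent ℝ fun p : Fin n × Fin M => (Q * P p.1).col p.2 := by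
      refine LinearIndependent.of_comp (A * Q⁻¹).mulVecLin ?_
      have h := linearIndependent_col_of_orthogonal_blocks (G := fun n => A * P n)
        (fun m (hm : m < n) => hGram m hm.le) (fun l hl => horth l hl.le)
      convert h using 1
      ext p : 1
      simp only [← hT]
      rfl
    have hspan : Submodule.span ℝ (Set.range fun p : Fin n × Fin M => (Q * P p.1).col p.2) =
        blockKrylov (A * Q⁻¹) (R 0) n := by
      refine Submodule.eq_of_le_of_finrank_le (Submodule.span_le.2 ?_) ?_
      · rintro _ ⟨p, rfl⟩
        exact blockKrylov_mono _ _ p.1.2 ((hmem p.1).2 p.2)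
      · rw [finrank_span_eq_card hind]
        exact finrank_blockKrylov_le _ _ _
    change y ∈ blockKrylov (A * Q⁻¹) (R 0) n at hy
    rw [← hspan] at hy
    induction hy using Submodule.span_induction with
    | mem y hy =>
      obtain ⟨⟨m, i⟩, rfl⟩ := hy
      have h : (A * Q⁻¹) *ᵥ (Q * P m).col i = (A * P m).col i := by
        rw [← hT]
        rfl
      rw [h, dotProduct_comm]
      exact congrFun (congrFun (hres n le_rfl m m.2) i) k
    | zero => simp
    | add x y _ _ hx hy => rw [Matrix.mulVec_add, dotProduct_add, hx, hy, add_zero]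
    | smul c x _ hx => rw [Matrix.mulVec_smul, dotProduct_smul, hx, smul_zero]
end
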